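/- Let n ≥ 2, let r ≥ 1 be an integer with r ≤ n, let k ∈ {1, 2, …, ⌊n/2⌋}, and set α = min{k, r} and β = min{k−1, n−r}. Then for every nonnegative integer d, the multiplicity of F_d in ∧^k ℂ^n under the sl_2-subalgebra s_{[r,1^{n−r}]} of sl_n(ℂ) of type [r, 1, 1, …, 1] (with n−r ones) equals Σ_{j=k−α}^{β} C(n−r, j) · mult(F_d : ∧^{k−j} ℂ^r under the principal sl_2-subalgebra of sl_r(ℂ)) + C(n−r, k) · [d = 0], where C(a,b) denotes the binomial coefficient (taken to be 0 if b > a), [d=0] is 1 if d=0 and 0 otherwise, and ∧^r ℂ^r is regarded as the trivial one-dimensional representation F_0. -/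

import Mathlib

/-- Index set for the standard basis of `⋀^k ℂ^n`: a subset `S` of size `k`
encodes the wedge `e_{i_1} ∧ ⋯ ∧ e_{i_k}` over the elements of `S` in increasing order. -/
abbrev WedgeIdx (n k : ℕ) := {S : Finset (Fin n) // S.card = k}

/-- Model of the exterior power `⋀^k ℂ^n`, presented via its standard basis of
wedges of standard basis vectors. -/
abbrev Wedge (n k : ℕ) := WedgeIdx n k →₀ ℂ

/-- The action on `⋀^k ℂ^n` (as a derivation) of the diagonal matrix with diagonal
entries `h`: the basis wedge indexed by `S` is an eigenvector of eigenvalue `∑ i ∈ S, h i`. -/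
noncomputable def wedgeH (n k : ℕ) (h : Fin n → ℤ) : Module.End ℂ (Wedge n k) :=
  (Finsupp.basisSingleOne (R := ℂ)).constr ℂ fun S =>
    ((∑ i ∈ S.1, h i : ℤ) : ℂ) • Finsupp.single S 1

/-- `dim V_j`: the dimension of the eigenvalue-`j` eigenspace of the diagonal action. -/
noncomputable def eigdim (n k : ℕ) (h : Fin n → ℤ) (j : ℤ) : ℕ :=
  Module.finrank ℂ ↥(Module.End.eigenspace (wedgeH n k h) (j : ℂ))

/-- The multiplicity of the irreducible `sl₂`-representation `F_j` in `⋀^k ℂ^n`: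
`dim V_j - dim V_{j+2}`. -/
noncomputable def multF (n k : ℕ) (h : Fin n → ℤ) (j : ℤ) : ℤ :=
  (eigdim n k h j : ℤ) - eigdim n k h (j + 2)

/-- The diagonal of `H_n = diag (n-1, n-3, …, -(n-1))`, the semisimple element of the
principal `sl₂`-triple of `sl_n(ℂ)` (0-indexed: entry `i` is `n - 1 - 2i`). -/
def hPrin (n : ℕ) : Fin n → ℤ := fun i => (n : ℤ) - 1 - 2 * (i : ℕ)

/-- The list of diagonal entries of the semisimple element `H_{[d_1,…,d_m]}`: the
concatenation of the strings `(r - 1, r - 3, …, -(r - 1))` over the parts `r` of the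
partition. -/
def blockDiag (L : List ℕ) : List ℤ :=
  L.flatMap fun r => (List.range r).map fun t => (r : ℤ) - 1 - 2 * (t : ℤ)

/-- Coordinates of the diagonal action on the wedge basis. -/
theorem wedgeH_apply (n k : ℕ) (h : Fin n → ℤ) (f : Wedge n k) (S : WedgeIdx n k) :
    wedgeH n k h f S = ((∑ i ∈ S.1, h i : ℤ) : ℂ) * f S := by
  induction f using Finsupp.induction_linear with
  | zero => simp
  | add f g hf hg => simp [map_add, hf, hg, mul_add]
  | single T c =>
    rw [wedgeH, Module.Basis.constr_apply]
    by_cases hTS : T = S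
    · subst hTS
      simp [mul_comm]
    · simp [hTS]

theorem eigenspace_wedgeH (n k : ℕ) (h : Fin n → ℤ) (j : ℤ) :
    Module.End.eigenspace (wedgeH n k h) (j : ℂ) =
      Finsupp.supported ℂ ℂ {S : WedgeIdx n k | ∑ i ∈ S.1, h i = j} := by
  ext f
  rw [Module.End.mem_eigenspace_iff, Finsupp.mem_supported']
  constructor
  · intro hf S hS
    have hS' := DFunLike.congr_fun hf S
    rw [wedgeH_apply, Finsupp.smul_apply, smul_eq_mul] at hS'
    by_contra h0
    exact hS (by exact_mod_cast mul_right_cancel₀ h0 hS')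
  · intro hf
    ext S
    rw [wedgeH_apply, Finsupp.smul_apply, smul_eq_mul]
    by_cases hS : ∑ i ∈ S.1, h i = j
    · rw [hS]
    · simp [hf S hS]

/-- Weight spaces of `⋀^k ℂ^n` are counted by the `k`-subsets with the given weight. -/
theorem eigdim_eq_card (n k : ℕ) (h : Fin n → ℤ) (j : ℤ) :
    eigdim n k h j =
      (Finset.univ.filter fun S : Finset (Fin n) => S.card = k ∧ ∑ i ∈ S, h i = j).card := by
  rw [eigdim, eigenspace_wedgeH, (Finsupp.supportedEquivFinsupp _).finrank_eq,
    Module.finrank_finsupp_self, ← Fintype.card_subtype]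
  exact Fintype.card_congr
    (Equiv.subtypeSubtypeEquivSubtypeInter _ fun S : Finset (Fin n) => ∑ i ∈ S, h i = j)

/-- Counting subsets of a disjoint union by size and weight, when the weight vanishes on the
second summand. -/
theorem card_filter_sum_of_inr_eq_zero {α β : Type*} [Fintype α] [Fintype β]
    [DecidableEq α] [DecidableEq β] (h : α ⊕ β → ℤ) (h0 : ∀ b, h (Sum.inr b) = 0)
    (k : ℕ) (j : ℤ) :
    (Finset.univ.filter fun S : Finset (α ⊕ β) => S.card = k ∧ ∑ i ∈ S, h i = j).card =
      ∑ i ∈ Finset.range (Fintype.card β + 1), (Fintype.card β).choose i *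
        (Finset.univ.filter fun A : Finset α =>
          A.card + i = k ∧ ∑ a ∈ A, h (Sum.inl a) = j).card := by
  have hsum := Finset.sum_powerset_apply_card (x := (Finset.univ : Finset β))
    (fun i => (Finset.univ.filter fun A : Finset α =>
      A.card + i = k ∧ ∑ a ∈ A, h (Sum.inl a) = j).card)
  simp only [Finset.powerset_univ, Finset.card_univ, smul_eq_mul] at hsum
  rw [← hsum, ← Finset.card_sigma]
  refine Finset.card_bij' (fun S _ => ⟨S.toRight, S.toLeft⟩) (fun p _ => p.2.disjSum p.1)
    ?_ ?_ ?_ ?_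
  · intro S hS
    rw [← Finset.toLeft_disjSum_toRight (u := S)] at hS
    simpa [h0] using hS
  · rintro ⟨B, A⟩ hp
    simpa [h0] using hp
  · intro S _
    exact Finset.toLeft_disjSum_toRight
  · rintro ⟨B, A⟩ _
    simp

theorem card_filter_map_equiv {α β : Type*} [Fintype α] [Fintype β]
    [DecidableEq α] [DecidableEq β] (e : α ≃ β) (h : β → ℤ) (k : ℕ) (j : ℤ) :
    (Finset.univ.filter fun S : Finset β => S.card = k ∧ ∑ i ∈ S, h i = j).card =
      (Finset.univ.filter fun S : Finset α => S.card = k ∧ ∑ i ∈ S, h (e i) = j).card := by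
  symm
  refine Finset.card_equiv e.finsetCongr fun S => ?_
  simp

theorem eigdim_add_of_natAdd_eq_zero (r m k : ℕ) (h : Fin (r + m) → ℤ)
    (h0 : ∀ b, h (Fin.natAdd r b) = 0) (j : ℤ) :
    eigdim (r + m) k h j = ∑ i ∈ Finset.range (m + 1), m.choose i *
      (if i ≤ k then eigdim r (k - i) (fun a => h (Fin.castAdd m a)) j else 0) := by
  rw [eigdim_eq_card, card_filter_map_equiv finSumFinEquiv,
    card_filter_sum_of_inr_eq_zero _ (by simpa using h0), Fintype.card_fin]
  refine Finset.sum_congr rfl fun i _ => ?_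
  congr 1
  split_ifs with hi
  · rw [eigdim_eq_card]
    refine congrArg Finset.card (Finset.filter_congr fun A _ => ?_)
    refine and_congr (by omega) ?_
    simp only [finSumFinEquiv_apply_left]
  · rw [Finset.card_eq_zero, Finset.filter_eq_empty_iff]
    intro A _ hA
    omega

theorem multF_add_of_natAdd_eq_zero (r m k : ℕ) (h : Fin (r + m) → ℤ)
    (h0 : ∀ b, h (Fin.natAdd r b) = 0) (j : ℤ) :
    multF (r + m) k h j = ∑ i ∈ Finset.range (m + 1), (m.choose i : ℤ) *
      (if i ≤ k then multF r (k - i) (fun a => h (Fin.castAdd m a)) j else 0) := by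
  simp only [multF, eigdim_add_of_natAdd_eq_zero r m k h h0]
  push_cast
  rw [← Finset.sum_sub_distrib]
  refine Finset.sum_congr rfl fun i _ => ?_
  split_ifs <;> ring

theorem eigdim_zero (r : ℕ) (h : Fin r → ℤ) (j : ℤ) :
    eigdim r 0 h j = if j = 0 then 1 else 0 := by
  rw [eigdim_eq_card]
  split_ifs with hj
  · subst hj
    rw [Finset.card_eq_one]
    refine ⟨∅, ?_⟩
    ext A
    simp only [Finset.mem_filter, Finset.mem_univ, true_and, Finset.card_eq_zero,
      Finset.mem_singleton]
    exact ⟨fun hA => hA.1, fun hA => ⟨hA, by simp [hA]⟩⟩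
  · rw [Finset.card_eq_zero, Finset.filter_eq_empty_iff]
    rintro A _ ⟨hA, hs⟩
    rw [Finset.card_eq_zero] at hA
    exact hj (by simpa [hA] using hs.symm)

theorem multF_zero (r : ℕ) (h : Fin r → ℤ) (d : ℕ) :
    multF r 0 h d = if d = 0 then 1 else 0 := by
  have : (d : ℤ) + 2 ≠ 0 := by omega
  simp [multF, eigdim_zero, this]

theorem eigdim_of_lt (r k : ℕ) (hk : r < k) (h : Fin r → ℤ) (j : ℤ) :
    eigdim r k h j = 0 := by
  rw [eigdim_eq_card, Finset.card_eq_zero, Finset.filter_eq_empty_iff]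
  rintro A _ ⟨hA, -⟩
  have := A.card_le_univ
  rw [Fintype.card_fin] at this
  omega

theorem multF_of_lt (r k : ℕ) (hk : r < k) (h : Fin r → ℤ) (j : ℤ) :
    multF r k h j = 0 := by
  simp [multF, eigdim_of_lt r k hk]

theorem blockDiag_cons_replicate_one (r m : ℕ) :
    blockDiag (r :: List.replicate m 1) =
      (List.range r).map (fun t : ℕ => (r : ℤ) - 1 - 2 * (t : ℤ)) ++ List.replicate m 0 := by
  simp [blockDiag, List.flatMap_replicate, List.map_flatMap]
  exact List.map_eq_flatMap.symm

theorem getD_blockDiag_of_lt (r m i : ℕ) (hi : i < r) :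
    (blockDiag (r :: List.replicate m 1)).getD i 0 = (r : ℤ) - 1 - 2 * (i : ℤ) := by
  rw [blockDiag_cons_replicate_one, List.getD_append _ _ _ _ (by simpa using hi)]
  simp [List.getD, hi]

theorem getD_blockDiag_add (r m b : ℕ) :
    (blockDiag (r :: List.replicate m 1)).getD (r + b) 0 = 0 := by
  rw [blockDiag_cons_replicate_one, List.getD_append_right _ _ _ _ (by simp)]
  simp [List.getD, List.getElem?_replicate]
  split_ifs <;> rfl

/-- for `1 ≤ r ≤ n`, `1 ≤ k ≤ ⌊n/2⌋`, `α = min {k, r}`,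
`β = min {k - 1, n - r}`, and every `d ≥ 0`, the multiplicity of `F_d` in `⋀^k ℂ^n` under
the subalgebra `s_{[r,1^{n-r}]}` of type `[r, 1, …, 1]` equals
`∑_{j = k - α}^{β} C(n-r, j) · mult(F_d : ⋀^{k-j} ℂ^r) + C(n-r, k) · [d = 0]`,
where `⋀^{k-j} ℂ^r` carries the principal `sl₂`-action of `sl_r(ℂ)` (and `⋀^r ℂ^r` is the
trivial representation `F₀`). -/
theorem stmt12 (n r k : ℕ) (hn : 2 ≤ n) (hr1 : 1 ≤ r) (hrn : r ≤ n)
    (hk1 : 1 ≤ k) (hk2 : k ≤ n / 2) (d : ℕ) :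
    multF n k (fun i => (blockDiag (r :: List.replicate (n - r) 1)).getD i 0) d =
      (∑ j ∈ Finset.Icc (k - min k r) (min (k - 1) (n - r)),
        (Nat.choose (n - r) j : ℤ) * multF r (k - j) (hPrin r) d)
      + (Nat.choose (n - r) k : ℤ) * (if d = 0 then 1 else 0) := by
  obtain ⟨m, rfl⟩ := Nat.exists_eq_add_of_le hrn
  simp only [Nat.add_sub_cancel_left]
  rw [multF_add_of_natAdd_eq_zero]
  swap
  · intro b
    simpa using getD_blockDiag_add r m b
  have hh : (fun a : Fin r => (blockDiag (r :: List.replicate m 1)).getD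
      ((Fin.castAdd m a : Fin (r + m)) : ℕ) 0) = hPrin r := by
    funext a
    simpa [hPrin] using getD_blockDiag_of_lt r m a a.2
  rw [hh, ← multF_zero r (hPrin r) d]
  have hk : k ∉ Finset.Icc (k - min k r) (min (k - 1) m) := by
    rw [Finset.mem_Icc]
    omega
  have hins := Finset.sum_insert (f := fun j => (m.choose j : ℤ) *
    (if j ≤ k then multF r (k - j) (hPrin r) d else 0)) hk
  simp only [le_refl, if_true, Nat.sub_self] at hins
  have hIcc : ∑ j ∈ Finset.Icc (k - min k r) (min (k - 1) m),
        (m.choose j : ℤ) * multF r (k - j) (hPrin r) d =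
      ∑ j ∈ Finset.Icc (k - min k r) (min (k - 1) m), (m.choose j : ℤ) *
        (if j ≤ k then multF r (k - j) (hPrin r) d else 0) := by
    refine Finset.sum_congr rfl fun j hj => ?_
    rw [Finset.mem_Icc] at hj
    rw [if_pos (by omega)]
  rw [hIcc, add_comm (Finset.sum _ _), ← hins]
  refine Finset.sum_congr_of_eq_on_inter ?_ ?_ fun _ _ _ => rfl
  · intro j hj hj'
    rw [Finset.mem_range] at hj
    rw [Finset.mem_insert, Finset.mem_Icc, not_or] at hj'
    split_ifs with hjk
    · rw [multF_of_lt r (k - j) (by omega), mul_zero]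
    · rw [mul_zero]
  · intro j _ hj'
    rw [Finset.mem_range] at hj'
    rw [Nat.choose_eq_zero_of_lt (by omega), Nat.cast_zero, zero_mul]
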